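/- Let Γ be a finite normal-form game with identical interests and let C be a permutation-invariant partition of the player set. Let (q(t), q̄(t)) be any discrete-time ECFP process with respect to (Γ, C) (step sizes γ_t ≥ 0 with ∑_t γ_t = ∞ and γ_t → 0, and best-response perturbations ε_t → 0). Then the centroid distributions learn symmetric Nash equilibria: dist(q̄(t), SNE) → 0 as t → ∞. -/

import Mathlib

open MeasureTheory Filter Topology

noncomputable section

namespace ECFP

variable {ι A κ : Type*}

/-- The mixed-strategy simplex over a finite action set `Y` inside the action universe `A`. -/
def simplex (Y : Finset A) : Set (A → ℝ) :=
  {p | (∀ a, 0 ≤ p a) ∧ (∀ a, a ∉ Y → p a = 0) ∧ ∑ a ∈ Y, p a = 1}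

/-- The space `Δⁿ` of joint mixed strategies. -/
def Delta (Y : ι → Finset A) : Set (ι → A → ℝ) :=
  {p | ∀ i, p i ∈ simplex (Y i)}

variable [Fintype ι] [DecidableEq ι] [Fintype A] [DecidableEq κ]

/-- The mixed extension of the common utility `u`:
`U(p₁,…,pₙ) = ∑_y u(y) p₁(y₁)⋯pₙ(yₙ)`. -/
def U (u : (ι → A) → ℝ) (p : ι → A → ℝ) : ℝ :=
  ∑ y : ι → A, u y * ∏ i, p i (y i)

/-- The `ε`-best-response set of player `i` against the joint strategy `p`
(only the components `p_{-i}` matter, since player `i`'s component is overwritten):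
`{pᵢ ∈ Δᵢ : U(pᵢ,p_{-i}) ≥ U(qᵢ,p_{-i}) - ε  ∀ qᵢ ∈ Δᵢ}`. -/
def BRi (Y : ι → Finset A) (u : (ι → A) → ℝ) (ε : ℝ) (p : ι → A → ℝ) (i : ι) :
    Set (A → ℝ) :=
  {pi | pi ∈ simplex (Y i) ∧
    ∀ qi ∈ simplex (Y i),
      U u (Function.update p i pi) ≥ U u (Function.update p i qi) - ε}

/-- The joint `ε`-best-response set `BR^ε(p) = (BR₁^ε(p_{-1}),…,BRₙ^ε(p_{-n}))`. -/
def BR (Y : ι → Finset A) (u : (ι → A) → ℝ) (ε : ℝ) (p : ι → A → ℝ) :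
    Set (ι → A → ℝ) :=
  {b | ∀ i, b i ∈ BRi Y u ε p i}

/-- The profile obtained from `y` by swapping the strategies of players `i` and `j`. -/
def swapStrat (y : ι → A) (i j : ι) : ι → A :=
  Function.update (Function.update y i (y j)) j (y i)

/-- `cls : ι → κ` encodes a permutation-invariant partition of the player set (the classes
are the fibers of `cls`): players in the same class have the same action set, and the utility
is invariant under swapping the strategies of two same-class players in any strategy profile. -/
def PermInvariant (Y : ι → Finset A) (u : (ι → A) → ℝ) (cls : ι → κ) : Prop :=
  ∀ i j : ι, cls i = cls j →
    Y i = Y j ∧ ∀ y : ι → A, (∀ k, y k ∈ Y k) → u (swapStrat y i j) = u y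

/-- The equivalence class (as a finset of players) of player `i`. -/
def cluster (cls : ι → κ) (i : ι) : Finset ι :=
  Finset.univ.filter (fun j => cls j = cls i)

/-- The centroid distribution `p̄`: player `i` is assigned the average of the strategies of
the players in `i`'s class. -/
def centroid (cls : ι → κ) (p : ι → A → ℝ) : ι → A → ℝ :=
  fun i => ((cluster cls i).card : ℝ)⁻¹ • ∑ j ∈ cluster cls i, p j

/-- A joint strategy is class-constant if same-class players use identical strategies. -/
def classConst (cls : ι → κ) (p : ι → A → ℝ) : Prop :=
  ∀ i j, cls i = cls j → p i = p j

/-- The set of Nash equilibria. -/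
def NE (Y : ι → Finset A) (u : (ι → A) → ℝ) : Set (ι → A → ℝ) :=
  {p | p ∈ Delta Y ∧ ∀ i, ∀ qi ∈ simplex (Y i),
    U u (Function.update p i qi) ≤ U u p}

/-- The set of symmetric Nash equilibria relative to the partition `cls`. -/
def SNE (Y : ι → Finset A) (u : (ι → A) → ℝ) (cls : ι → κ) : Set (ι → A → ℝ) :=
  {p | p ∈ NE Y u ∧ classConst cls p}

/-- The set of mean-centric equilibria relative to the partition `cls`:
`U(pᵢ, p̄_{-i}) ≥ U(pᵢ', p̄_{-i})` for all `pᵢ' ∈ Δᵢ` and all `i`. -/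
def MCE (Y : ι → Finset A) (u : (ι → A) → ℝ) (cls : ι → κ) : Set (ι → A → ℝ) :=
  {p | p ∈ Delta Y ∧ ∀ i, ∀ qi ∈ simplex (Y i),
    U u (Function.update (centroid cls p) i qi)
      ≤ U u (Function.update (centroid cls p) i (p i))}

/-- `V(p) = (1/n) ∑ᵢ U(pᵢ, p̄_{-i})`. -/
def Vfun (u : (ι → A) → ℝ) (cls : ι → κ) (p : ι → A → ℝ) : ℝ :=
  (Fintype.card ι : ℝ)⁻¹ * ∑ i, U u (Function.update (centroid cls p) i (p i))

/-- A discrete-time ECFP process w.r.t. `(Γ, 𝒞)`: `q(1) = a(1)`,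
`q(t+1) = q(t) + γₜ (a(t+1) − q(t))` and `a(t+1) ∈ BR^{εₜ}(q̄(t))` for all `t`
(time is indexed by `ℕ`, i.e. `t = 0` plays the role of `t = 1` in the paper). -/
structure IsECFP (Y : ι → Finset A) (u : (ι → A) → ℝ) (cls : ι → κ)
    (γ ε : ℕ → ℝ) (a q : ℕ → ι → A → ℝ) : Prop where
  a_init_mem : a 0 ∈ Delta Y
  q_mem : ∀ t, q t ∈ Delta Y
  init : q 0 = a 0
  step : ∀ t, q (t + 1) = q t + γ t • (a (t + 1) - q t)
  br : ∀ t, a (t + 1) ∈ BR Y u (ε t) (centroid cls (q t))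

/-- A solution of the differential inclusion `ẋ ∈ F(x)` taking values in `Δⁿ`:
an everywhere-`Δⁿ`-valued trajectory on `[0,∞)` which is the integral of a locally
integrable selection `g(t) ∈ F(x(t))` (a.e.). -/
def IsSolution (Y : ι → Finset A) (F : (ι → A → ℝ) → Set (ι → A → ℝ))
    (x : ℝ → ι → A → ℝ) : Prop :=
  (∀ t : ℝ, 0 ≤ t → x t ∈ Delta Y) ∧
  ∃ g : ℝ → ι → A → ℝ,
    LocallyIntegrableOn g (Set.Ici (0 : ℝ)) ∧
    (∀ᵐ t ∂(volume.restrict (Set.Ici (0 : ℝ))), g t ∈ F (x t)) ∧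
    ∀ t : ℝ, 0 ≤ t → x t = x 0 + ∫ s in Set.Ioc (0 : ℝ) t, g s

/-- Right-hand side of the joint CT-ECFP differential inclusion `q̇ ∈ BR(q̄) − q`. -/
def Fjoint (Y : ι → Finset A) (u : (ι → A) → ℝ) (cls : ι → κ)
    (q : ι → A → ℝ) : Set (ι → A → ℝ) :=
  (fun b => b - q) '' BR Y u 0 (centroid cls q)

/-- Right-hand side of the centroid CT-ECFP differential inclusion `ẏ ∈ BR(y) − y`. -/
def Fcent (Y : ι → Finset A) (u : (ι → A) → ℝ)
    (y : ι → A → ℝ) : Set (ι → A → ℝ) :=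
  (fun b => b - y) '' BR Y u 0 y

/-- The ω-limit set of a continuous-time trajectory: all limits of sequences
`x(t_k)` with `t_k → ∞`. -/
def omegaLimitSet (x : ℝ → ι → A → ℝ) : Set (ι → A → ℝ) :=
  {p | ∃ tk : ℕ → ℝ, Tendsto tk atTop atTop ∧ Tendsto (fun k => x (tk k)) atTop (𝓝 p)}

/-- The set of limit points of a (discrete-time) sequence. -/
def seqLimitPoints (q : ℕ → ι → A → ℝ) : Set (ι → A → ℝ) :=
  {p | ∃ φ : ℕ → ℕ, StrictMono φ ∧ Tendsto (fun k => q (φ k)) atTop (𝓝 p)}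

/-- A compact set `X ⊆ Δⁿ` is internally chain transitive for the inclusion `ẋ ∈ F(x)`:
any two points of `X` can be joined, for every `ε > 0` and `T > 0`, by finitely many
solution pieces of duration `> T` staying in `X`, with jumps of size `≤ ε`. -/
def InternallyChainTransitive (Y : ι → Finset A)
    (F : (ι → A → ℝ) → Set (ι → A → ℝ)) (X : Set (ι → A → ℝ)) : Prop :=
  IsCompact X ∧ X ⊆ Delta Y ∧
  ∀ ξ ∈ X, ∀ η ∈ X, ∀ ε : ℝ, 0 < ε → ∀ T : ℝ, 0 < T →
    ∃ k : ℕ, 0 < k ∧ ∃ x : ℕ → ℝ → ι → A → ℝ, ∃ tt : ℕ → ℝ,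
      (∀ i < k, IsSolution Y F (x i)) ∧
      (∀ i < k, T < tt i) ∧
      (∀ i < k, ∀ s : ℝ, 0 ≤ s → s ≤ tt i → x i s ∈ X) ∧
      (∀ i, i + 1 < k → ‖x i (tt i) - x (i + 1) 0‖ ≤ ε) ∧
      ‖x 0 0 - ξ‖ ≤ ε ∧ ‖x (k - 1) (tt (k - 1)) - η‖ ≤ ε

open scoped Polynomial KaehlerDifferential TensorProduct

/-- In characteristic zero, elements with vanishing differential are algebraic. -/
theorem isAlgebraic_of_kaehlerDifferential_D_eq_zero {K L : Type*} [Field K] [CharZero K] [Field L]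
    [Algebra K L] [Algebra.EssFiniteType K L] {z : L} (hz : KaehlerDifferential.D K L z = 0) :
    IsAlgebraic K z := by
  by_contra htr
  have hinj := transcendental_iff_injective.1 htr
  let : Algebra K[X] L := (Polynomial.aeval z).toAlgebra
  have : IsScalarTower K K[X] L := .of_algHom (Polynomial.aeval z)
  have : FaithfulSMul K[X] L := (faithfulSMul_iff_algebraMap_injective _ _).2 hinj
  let : Algebra (FractionRing K[X]) L := FractionRing.liftAlgebra K[X] L
  have : IsScalarTower K[X] (FractionRing K[X]) L := inferInstance
  have : IsScalarTower K (FractionRing K[X]) L := .to₁₃₄ K K[X] (FractionRing K[X]) L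
  have : Algebra.EssFiniteType (FractionRing K[X]) L := .of_comp K _ _
  have : CharZero (FractionRing K[X]) := algebraRat.charZero _
  have : Algebra.FormallySmooth K[X] (FractionRing K[X]) :=
    .of_isLocalization (nonZeroDivisors K[X])
  have : Algebra.FormallySmooth K[X] L := .comp _ (FractionRing K[X]) _
  have : Subsingleton (Algebra.H1Cotangent K[X] L) :=
    Algebra.FormallySmooth.subsingleton_h1Cotangent
  have hbc : Function.Injective (KaehlerDifferential.mapBaseChange K K[X] L) := by
    refine (injective_iff_map_eq_zero _).2 fun w hw => ?_
    obtain ⟨v, rfl⟩ := (Algebra.H1Cotangent.exact_δ_mapBaseChange K K[X] L w).1 hw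
    rw [Subsingleton.elim v 0, map_zero]
  have hX : (1 : L) ⊗ₜ[K[X]] KaehlerDifferential.D K K[X] Polynomial.X = 0 := by
    refine hbc ?_
    rw [KaehlerDifferential.mapBaseChange_tmul, map_zero, KaehlerDifferential.map_D, one_smul]
    convert! hz
    exact Polynomial.aeval_X z
  have := congrArg (LinearMap.liftBaseChange L ((Algebra.linearMap K[X] L).comp
    (KaehlerDifferential.polynomialEquiv K).toLinearMap)) hX
  simp at this

theorem exists_isNilpotent_aeval_of_forall_prime {K R : Type*} [Field K] [CharZero K] [CommRing R]
    [Algebra K R] [Algebra.FiniteType K R] {f : R}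
    (hf : ∀ (P : Ideal R) [P.IsPrime], KaehlerDifferential.D K (FractionRing (R ⧸ P))
      (algebraMap R (FractionRing (R ⧸ P)) f) = 0) :
    ∃ p : K[X], p ≠ 0 ∧ IsNilpotent (Polynomial.aeval f p) := by
  classical
  have : IsNoetherianRing R := Algebra.FiniteType.isNoetherianRing K R
  have hprime : ∀ P : Ideal R, P.IsPrime → ∃ p : K[X], p ≠ 0 ∧ Polynomial.aeval f p ∈ P := by
    intro P _
    obtain ⟨p, hp, hpf⟩ := isAlgebraic_of_kaehlerDifferential_D_eq_zero (hf P)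
    refine ⟨p, hp, ?_⟩
    rw [Polynomial.aeval_algebraMap_apply,
      IsScalarTower.algebraMap_apply R (R ⧸ P) (FractionRing (R ⧸ P))] at hpf
    rw [← Ideal.Quotient.eq_zero_iff_mem]
    exact (FaithfulSMul.algebraMap_eq_zero_iff _ _).1 hpf
  choose! p hp hpf using hprime
  have hfin := (⊥ : Ideal R).finite_minimalPrimes_of_isNoetherianRing
  refine ⟨∏ P ∈ hfin.toFinset, p P, Finset.prod_ne_zero_iff.2 fun P hP =>
    hp P (hfin.mem_toFinset.1 hP).1.1, ?_⟩
  rw [← mem_nilradical, nilradical, ← Ideal.sInf_minimalPrimes, Ideal.mem_sInf]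
  intro P hP
  rw [map_prod]
  exact Ideal.mem_of_dvd _ (Finset.dvd_prod_of_mem _ (hfin.mem_toFinset.2 hP)) (hpf P hP.1.1)

/-- A function in a finitely generated algebra of functions whose differential vanishes at every
prime takes only finitely many values. -/
theorem finite_range_of_forall_prime {K S : Type*} [Field K] [CharZero K]
    {R : Subalgebra K (S → K)} (hR : R.FG) {f : R}
    (hf : ∀ (P : Ideal R) [P.IsPrime], KaehlerDifferential.D K (FractionRing (R ⧸ P))
      (algebraMap R (FractionRing (R ⧸ P)) f) = 0) :
    (Set.range (f : S → K)).Finite := by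
  have : Algebra.FiniteType K R := R.fg_iff_finiteType.1 hR
  obtain ⟨p, hp, n, hn⟩ := exists_isNilpotent_aeval_of_forall_prime hf
  refine (Polynomial.finite_setOfPred_isRoot hp).subset ?_
  rintro _ ⟨s, rfl⟩
  have := congrArg ((Pi.evalAlgHom K (fun _ : S => K) s).comp R.val) hn
  rw [map_pow, ← Polynomial.aeval_algHom_apply, map_zero] at this
  simpa [Polynomial.aeval_def] using eq_zero_of_pow_eq_zero this

theorem exists_pos_forall_exists_le {E J : Type*} [TopologicalSpace E] {K : Set E}
    (hK : IsCompact K) {d : J → E → ℝ} (hd : ∀ j, Continuous (d j))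
    (hpos : ∀ p ∈ K, ∃ j, 0 < d j p) : ∃ g > 0, ∀ p ∈ K, ∃ j, g ≤ d j p := by
  refine hK.induction_on (p := fun s => ∃ g > 0, ∀ p ∈ s, ∃ j, g ≤ d j p)
    ⟨1, one_pos, by simp⟩ ?_ ?_ ?_
  · rintro s t hst ⟨g, hg, h⟩
    exact ⟨g, hg, fun p hp => h p (hst hp)⟩
  · rintro s t ⟨g, hg, h⟩ ⟨g', hg', h'⟩
    refine ⟨min g g', lt_min hg hg', ?_⟩
    rintro p (hp | hp)
    · exact (h p hp).imp fun j hj => (min_le_left _ _).trans hj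
    · exact (h' p hp).imp fun j hj => (min_le_right _ _).trans hj
  · intro p hp
    obtain ⟨j, hj⟩ := hpos p hp
    refine ⟨{z | d j p / 2 < d j z}, mem_nhdsWithin_of_mem_nhds ?_, d j p / 2, half_pos hj,
      fun z hz => ⟨j, le_of_lt hz⟩⟩
    exact (isOpen_lt continuous_const (hd j)).mem_nhds (half_lt_self hj)

section Lyapunov

variable {E J : Type*} [PseudoMetricSpace E] {K : Set E} {f : E → ℝ} {d : J → E → ℝ}
  {x : ℕ → E} {γ δ : ℕ → ℝ}

/-- A perturbed Lyapunov function converges along the process if it takes only finitely many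
values on the set where no ascent rate `d j` is positive. -/
theorem exists_tendsto_of_perturbed_ascent (hK : IsCompact K) (hf : Continuous f)
    (hd : ∀ j, Continuous (d j)) (hx : ∀ t, x t ∈ K) (hγnonneg : ∀ t, 0 ≤ γ t)
    (hγ0 : Tendsto γ atTop (𝓝 0)) (hδ0 : Tendsto δ atTop (𝓝 0))
    (hdrop : ∀ᶠ t in atTop, -(γ t * δ t) ≤ f (x (t + 1)) - f (x t))
    (hinc : ∀ᶠ t in atTop, ∀ j, γ t * (d j (x t) - δ t) ≤ f (x (t + 1)) - f (x t))
    (hfin : (f '' {p ∈ K | ∀ j, d j p ≤ 0}).Finite) :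
    ∃ l, Tendsto (fun t => f (x t)) atTop (𝓝 l) := by
  have hbdd := hK.image hf |>.isBounded
  have hmem : ∀ t, f (x t) ∈ f '' K := fun t => ⟨_, hx t, rfl⟩
  refine tendsto_of_no_upcrossings (hfin.countable.dense_compl ℝ) ?_ ?_ ?_
  · rintro a ha b - hab ⟨hlo, hhi⟩
    obtain ⟨r, hr, hball⟩ := Metric.isOpen_iff.1 hfin.isClosed.isOpen_compl a ha
    obtain ⟨g, hg, hgK⟩ := exists_pos_forall_exists_le
      (K := K ∩ f ⁻¹' Set.Icc a (a + r / 2)) (hK.inter_right (isClosed_Icc.preimage hf)) hd (by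
        rintro p ⟨hp, hpa, hpr⟩
        by_contra! hp0
        refine hball (show f p ∈ Metric.ball a r from ?_) ⟨p, ⟨hp, hp0⟩, rfl⟩
        rw [Metric.mem_ball, Real.dist_eq, abs_lt]
        constructor <;> linarith)
    have hγδ : Tendsto (fun t => γ t * δ t) atTop (𝓝 0) := by simpa using hγ0.mul hδ0
    have key : ∀ᶠ t in atTop, a ≤ f (x t) → a ≤ f (x (t + 1)) := by
      filter_upwards [hdrop, hinc, hδ0.eventually_le_const hg,
        hγδ.eventually_le_const (half_pos hr)] with t h1 h2 h3 h4 hat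
      by_cases hup : f (x t) ≤ a + r / 2
      · obtain ⟨j, hj⟩ := hgK (x t) ⟨hx t, hat, hup⟩
        have := mul_nonneg (hγnonneg t) (sub_nonneg.2 (h3.trans hj))
        linarith [h2 j]
      · linarith
    obtain ⟨T, hT⟩ := eventually_atTop.1 key
    obtain ⟨s, hs, hbs⟩ := frequently_atTop.1 hhi T
    have hstay : ∀ t, s ≤ t → a ≤ f (x t) := fun t hst => by
      induction t, hst using Nat.le_induction with
      | base => linarith
      | succ t hst ih => exact hT t (hs.trans hst) ih
    obtain ⟨t, ht, hat⟩ := frequently_atTop.1 hlo s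
    exact absurd (hstay t ht) (not_le.2 hat)
  · obtain ⟨B, hB⟩ := hbdd.bddAbove
    exact isBoundedUnder_of ⟨B, fun t => hB (hmem t)⟩
  · obtain ⟨B, hB⟩ := hbdd.bddBelow
    exact isBoundedUnder_of ⟨B, fun t => hB (hmem t)⟩

/-- A process of small steps along which `f` increases, up to asymptotically negligible errors,
at least at every rate `d j` approaches the set where no rate `d j` is positive. -/
theorem tendsto_infDist_of_perturbed_ascent (hK : IsCompact K) (hf : Continuous f)
    (hd : ∀ j, Continuous (d j)) (hx : ∀ t, x t ∈ K) (hγnonneg : ∀ t, 0 ≤ γ t)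
    (hγdiv : Tendsto (fun n => ∑ t ∈ Finset.range n, γ t) atTop atTop)
    (hγ0 : Tendsto γ atTop (𝓝 0)) (hδ0 : Tendsto δ atTop (𝓝 0))
    (hstep : ∀ t, dist (x t) (x (t + 1)) ≤ γ t)
    (hdrop : ∀ᶠ t in atTop, -(γ t * δ t) ≤ f (x (t + 1)) - f (x t))
    (hinc : ∀ᶠ t in atTop, ∀ j, γ t * (d j (x t) - δ t) ≤ f (x (t + 1)) - f (x t))
    (hfin : (f '' {p ∈ K | ∀ j, d j p ≤ 0}).Finite) :
    Tendsto (fun t => Metric.infDist (x t) {p ∈ K | ∀ j, d j p ≤ 0}) atTop (𝓝 0) := by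
  set Z := {p ∈ K | ∀ j, d j p ≤ 0}
  obtain ⟨l, hl⟩ :=
    exists_tendsto_of_perturbed_ascent hK hf hd hx hγnonneg hγ0 hδ0 hdrop hinc hfin
  refine tendsto_order.2 ⟨fun b hb => .of_forall fun t => hb.trans_le Metric.infDist_nonneg,
    fun η hη => ?_⟩
  obtain ⟨g, hg, hgK⟩ := exists_pos_forall_exists_le
    (K := K ∩ {p | η / 2 ≤ Metric.infDist p Z})
    (hK.inter_right (isClosed_le continuous_const (Metric.continuous_infDist_pt Z))) hd (by
      rintro p ⟨hp, hpη⟩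
      by_contra! hp0
      have : Metric.infDist p Z = 0 := Metric.infDist_zero_of_mem ⟨hp, hp0⟩
      rw [Set.mem_ofPred_eq, this] at hpη
      linarith)
  have hgη : 0 < g * η / 8 := by positivity
  obtain ⟨T, hT⟩ := eventually_atTop.1 <| (Metric.tendsto_nhds.1 hl _ hgη).and <|
    (hδ0.eventually_le_const (half_pos hg)).and hinc
  filter_upwards [eventually_ge_atTop T] with s hs
  by_contra! hsη
  have hclose : ∀ n, f (x (s + n)) - f (x s) ≤ g / 2 * (η / 2) := fun n => by
    have h1 := (hT (s + n) (by omega)).1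
    have h2 := (hT s hs).1
    rw [Real.dist_eq, abs_lt] at h1 h2
    linarith
  have hsum : ∀ n, g / 2 * ∑ r ∈ Finset.range n, γ (s + r) ≤ f (x (s + n)) - f (x s) := by
    intro n
    induction n with
    | zero => simp
    | succ n ih =>
      have hle : ∑ r ∈ Finset.range n, γ (s + r) ≤ η / 2 :=
        le_of_mul_le_mul_left (ih.trans (hclose n)) (half_pos hg)
      have hdist : dist (x s) (x (s + n)) ≤ ∑ r ∈ Finset.range n, γ (s + r) :=
        dist_le_range_sum_of_dist_le (f := fun r => x (s + r)) n fun _ => hstep _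
      have hfar : η / 2 ≤ Metric.infDist (x (s + n)) Z := by
        have := Metric.infDist_le_infDist_add_dist (s := Z) (x := x s) (y := x (s + n))
        linarith
      obtain ⟨j, hj⟩ := hgK _ ⟨hx (s + n), hfar⟩
      obtain ⟨-, hδ, hj'⟩ := hT (s + n) (by omega)
      have := mul_le_mul_of_nonneg_left (show g / 2 ≤ d j (x (s + n)) - δ (s + n) by linarith)
        (hγnonneg (s + n))
      rw [Finset.sum_range_succ, ← add_assoc]
      linarith [hj' j]
  obtain ⟨N, hN⟩ := (hγdiv.eventually_gt_atTop (∑ t ∈ Finset.range s, γ t + η / 2)).and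
    (eventually_ge_atTop s) |>.exists
  obtain ⟨n, rfl⟩ := Nat.exists_eq_add_of_le hN.2
  have := le_of_mul_le_mul_left ((hsum n).trans (hclose n)) (half_pos hg)
  rw [Finset.sum_range_add] at hN
  linarith [hN.1]

end Lyapunov
section MixedExt

variable {R : Type*} [CommRing R] [Algebra ℝ R]

/-- The mixed extension of `u` with strategies valued in a real algebra. -/
def mixedExt (u : (ι → A) → ℝ) (x : ι → A → R) : R :=
  ∑ y : ι → A, algebraMap ℝ R (u y) * ∏ i, x i (y i)

theorem mixedExt_real (u : (ι → A) → ℝ) (p : ι → A → ℝ) : mixedExt u p = U u p := rfl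

omit [Fintype A] [Algebra ℝ R] in
theorem prod_update_apply (x : ι → A → R) (i : ι) (v : A → R) (y : ι → A) :
    ∏ j, Function.update x i v j (y j) = v (y i) * ∏ j ∈ Finset.univ.erase i, x j (y j) := by
  rw [← Finset.mul_prod_erase _ _ (Finset.mem_univ i), Function.update_self]
  congr 1
  refine Finset.prod_congr rfl fun j hj => ?_
  rw [Function.update_of_ne (Finset.ne_of_mem_erase hj)]

theorem mixedExt_update [DecidableEq A] (u : (ι → A) → ℝ) (x : ι → A → R) (i : ι) (v : A → R) :
    mixedExt u (Function.update x i v) =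
      ∑ a, v a * mixedExt u (Function.update x i (Pi.single a 1)) := by
  simp only [mixedExt, Finset.mul_sum]
  rw [Finset.sum_comm]
  refine Finset.sum_congr rfl fun y _ => ?_
  simp only [prod_update_apply]
  rw [Finset.sum_eq_single (y i)]
  · simp; ring
  · intro a _ ha
    simp [Pi.single_eq_of_ne' ha]
  · simp

theorem map_mixedExt {S : Type*} [CommRing S] [Algebra ℝ S] (φ : R →ₐ[ℝ] S) (u : (ι → A) → ℝ)
    (x : ι → A → R) : φ (mixedExt u x) = mixedExt u (fun i a => φ (x i a)) := by
  simp [mixedExt]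

theorem map_mixedExt_update_single [DecidableEq A] {S : Type*} [CommRing S] [Algebra ℝ S]
    (φ : R →ₐ[ℝ] S) (u : (ι → A) → ℝ) (x : ι → A → R) (i : ι) (a : A) :
    φ (mixedExt u (Function.update x i (Pi.single a 1))) =
      mixedExt u (Function.update (fun i a => φ (x i a)) i (Pi.single a 1)) := by
  rw [map_mixedExt]
  congr 1
  ext j b
  by_cases hj : j = i
  · subst hj
    simp [Pi.single_apply, apply_ite φ]
  · simp [Function.update_of_ne hj]

omit [Fintype ι] in
theorem derivation_prod {M : Type*} [AddCommGroup M] [Module ℝ M] [Module R M]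
    (D : Derivation ℝ R M) (s : Finset ι) (g : ι → R) :
    D (∏ i ∈ s, g i) = ∑ i ∈ s, (∏ j ∈ s.erase i, g j) • D (g i) := by
  induction s using Finset.induction_on with
  | empty => simp
  | insert k s hk ih =>
    rw [Finset.prod_insert hk, D.leibniz, ih, Finset.sum_insert hk, Finset.erase_insert hk,
      Finset.smul_sum, add_comm]
    congr 1
    refine Finset.sum_congr rfl fun i hi => ?_
    have hki : k ≠ i := fun h => hk (h ▸ hi)
    rw [Finset.erase_insert_of_ne hki, Finset.prod_insert (fun h => hk (Finset.mem_of_mem_erase h)),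
      smul_smul]

theorem derivation_mixedExt [DecidableEq A] {M : Type*} [AddCommGroup M] [Module ℝ M] [Module R M]
    (D : Derivation ℝ R M) (u : (ι → A) → ℝ) (x : ι → A → R) :
    D (mixedExt u x) =
      ∑ i, ∑ a, mixedExt u (Function.update x i (Pi.single a 1)) • D (x i a) := by
  simp only [mixedExt, map_sum, prod_update_apply, Finset.sum_smul]
  simp only [D.leibniz, D.map_algebraMap, smul_zero, add_zero, derivation_prod, Finset.smul_sum]
  rw [Finset.sum_comm]
  refine Finset.sum_congr rfl fun i _ => ?_
  rw [Finset.sum_comm]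
  refine Finset.sum_congr rfl fun y _ => ?_
  rw [Finset.sum_eq_single (y i)]
  · simp [mul_smul]
  · intro a _ ha
    simp [Pi.single_eq_of_ne' ha]
  · simp

/-- The mixed extension is stationary along families of strategies satisfying the equilibrium
complementarity relations. -/
theorem derivation_mixedExt_eq_zero [IsDomain R] [DecidableEq A] {M : Type*} [AddCommGroup M]
    [Module ℝ M] [Module R M] (D : Derivation ℝ R M) (u : (ι → A) → ℝ) (x : ι → A → R)
    (hx : ∀ i, ∑ a, x i a = 1)
    (hxu : ∀ i a, x i a * (mixedExt u (Function.update x i (Pi.single a 1)) - mixedExt u x) = 0) :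
    D (mixedExt u x) = 0 := by
  have hterm : ∀ i a, mixedExt u (Function.update x i (Pi.single a 1)) • D (x i a) =
      mixedExt u x • D (x i a) := by
    intro i a
    rcases mul_eq_zero.1 (hxu i a) with h | h
    · simp [h]
    · rw [sub_eq_zero.1 h]
  rw [derivation_mixedExt]
  simp only [hterm, ← Finset.smul_sum, ← map_sum, hx, D.map_one_eq_zero, smul_zero,
    Finset.sum_const_zero]

theorem kaehlerDifferential_D_algebraMap_mixedExt [DecidableEq A] {L : Type*} [CommRing L]
    [IsDomain L] [Algebra ℝ L] [Algebra R L] [IsScalarTower ℝ R L] (u : (ι → A) → ℝ)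
    (x : ι → A → R) (hx : ∀ i, ∑ a, x i a = 1)
    (hxu : ∀ i a, x i a * (mixedExt u (Function.update x i (Pi.single a 1)) - mixedExt u x) = 0) :
    KaehlerDifferential.D ℝ L (algebraMap R L (mixedExt u x)) = 0 := by
  rw [← IsScalarTower.coe_toAlgHom' ℝ R L, map_mixedExt]
  refine derivation_mixedExt_eq_zero _ u _ (fun i => ?_) fun i a => ?_
  · rw [← map_sum, hx, map_one]
  · rw [← map_mixedExt_update_single, ← map_mixedExt, ← map_sub, ← map_mul, hxu, map_zero]

end MixedExt

section Equilibrium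

variable {Y : ι → Finset A} {u : (ι → A) → ℝ} {p : ι → A → ℝ}

omit [Fintype ι] [DecidableEq ι] in
theorem sum_eq_one_of_mem_Delta (hp : p ∈ Delta Y) (i : ι) : ∑ a, p i a = 1 := by
  rw [← (hp i).2.2]
  exact (Finset.sum_subset (Finset.subset_univ _) fun a _ ha => (hp i).2.1 a ha).symm

omit [Fintype A] in
theorem single_mem_simplex [DecidableEq A] {Y : Finset A} {a : A} (ha : a ∈ Y) :
    Pi.single a 1 ∈ simplex Y := by
  refine ⟨fun b => ?_, fun b hb => ?_, ?_⟩
  · rw [Pi.single_apply]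
    split_ifs <;> norm_num
  · exact Pi.single_eq_of_ne (by rintro rfl; exact hb ha) _
  · simp [ha, Pi.single_apply]

theorem mul_gain_eq_zero_of_mem_NE [DecidableEq A] (hp : p ∈ NE Y u) (i : ι) (a : A) :
    p i a * (U u (Function.update p i (Pi.single a 1)) - U u p) = 0 := by
  have hsum : ∑ a, p i a * (U u p - U u (Function.update p i (Pi.single a 1))) = 0 := by
    have h := mixedExt_update u p i (p i)
    simp only [Function.update_eq_self, mixedExt_real] at h
    simp only [mul_sub, Finset.sum_sub_distrib, ← Finset.sum_mul, sum_eq_one_of_mem_Delta hp.1]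
    rw [← h]
    ring
  have hnonneg : ∀ a, 0 ≤ p i a * (U u p - U u (Function.update p i (Pi.single a 1))) := by
    intro a
    by_cases ha : a ∈ Y i
    · exact mul_nonneg ((hp.1 i).1 a) (sub_nonneg.2 (hp.2 i _ (single_mem_simplex ha)))
    · simp [(hp.1 i).2.1 a ha]
  have := (Finset.sum_eq_zero_iff_of_nonneg fun a _ => hnonneg a).1 hsum a (Finset.mem_univ a)
  linarith

/-- A game with identical interests has finitely many equilibrium payoffs. -/
theorem finite_image_U_NE (Y : ι → Finset A) (u : (ι → A) → ℝ) : (U u '' NE Y u).Finite := by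
  classical
  let c : ι × A → NE Y u → ℝ := fun ia p => p.1 ia.1 ia.2
  let R : Subalgebra ℝ (NE Y u → ℝ) := Algebra.adjoin ℝ (Set.range c)
  let x : ι → A → R := fun i a => ⟨c (i, a), Algebra.subset_adjoin ⟨(i, a), rfl⟩⟩
  let ev : NE Y u → R →ₐ[ℝ] ℝ := fun p => (Pi.evalAlgHom ℝ (fun _ => ℝ) p).comp R.val
  have ev_ext : ∀ g h : R, (∀ p, ev p g = ev p h) → g = h := fun g h H =>
    Subtype.ext (funext H)
  have ev_U : ∀ p, ev p (mixedExt u x) = U u p.1 := fun p => map_mixedExt (ev p) u x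
  have hx : ∀ i, ∑ a, x i a = 1 := fun i => ev_ext _ _ fun p => by
    rw [map_sum, map_one]
    exact sum_eq_one_of_mem_Delta p.2.1 i
  have hxu : ∀ i a,
      x i a * (mixedExt u (Function.update x i (Pi.single a 1)) - mixedExt u x) = 0 :=
    fun i a => ev_ext _ _ fun p => by
      rw [map_mul, map_sub, map_zero, ev_U, map_mixedExt_update_single]
      exact mul_gain_eq_zero_of_mem_NE p.2 i a
  have hR : R.FG := Subalgebra.fg_def.2 ⟨_, Set.finite_range c, rfl⟩
  have hfin := finite_range_of_forall_prime hR (f := mixedExt u x) fun P _ =>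
    kaehlerDifferential_D_algebraMap_mixedExt u x hx hxu
  refine hfin.subset ?_
  rintro _ ⟨p, hp, rfl⟩
  exact ⟨⟨p, hp⟩, ev_U ⟨p, hp⟩⟩

end Equilibrium
section Symmetry

variable {Y : ι → Finset A} {u : (ι → A) → ℝ} {cls : ι → κ} {p : ι → A → ℝ} {i j : ι}

omit [Fintype ι] [Fintype A] in
theorem swapStrat_eq_comp_swap (y : ι → A) (i j : ι) : swapStrat y i j = y ∘ Equiv.swap i j := by
  ext k
  simp only [swapStrat, Function.update_apply, Function.comp_apply, Equiv.swap_apply_def]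
  split_ifs <;> simp_all

omit [DecidableEq κ] in
theorem U_comp_swap (hpi : PermInvariant Y u cls) (hp : p ∈ Delta Y) (hij : cls i = cls j) :
    U u (p ∘ Equiv.swap i j) = U u p := by
  unfold U
  rw [← ((Equiv.swap i j).arrowCongr (Equiv.refl A)).sum_comp]
  refine Finset.sum_congr rfl fun y _ => ?_
  have hprod : ∏ k, (p ∘ Equiv.swap i j) k ((Equiv.swap i j).arrowCongr (Equiv.refl A) y k) =
      ∏ k, p k (y k) := Equiv.prod_comp (Equiv.swap i j) fun k => p k (y k)
  rw [hprod]
  by_cases hy : ∀ k, y k ∈ Y k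
  · congr 1
    rw [← (hpi i j hij).2 y hy, swapStrat_eq_comp_swap]
    rfl
  · obtain ⟨k, hk⟩ := not_forall.1 hy
    rw [Finset.prod_eq_zero (Finset.mem_univ k) ((hp k).2.1 _ hk), mul_zero, mul_zero]

omit [Fintype ι] [Fintype A] in
theorem update_mem_Delta (hp : p ∈ Delta Y) {b : A → ℝ} (hb : b ∈ simplex (Y i)) :
    Function.update p i b ∈ Delta Y := by
  intro k
  by_cases hk : k = i
  · subst hk
    simpa using hb
  · simpa [Function.update_of_ne hk] using hp k

omit [DecidableEq κ] in
theorem U_update_eq_of_cls_eq (hpi : PermInvariant Y u cls) (hp : p ∈ Delta Y)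
    (hc : classConst cls p) (hij : cls i = cls j) {b : A → ℝ} (hb : b ∈ simplex (Y i)) :
    U u (Function.update p i b) = U u (Function.update p j b) := by
  rw [← U_comp_swap hpi (update_mem_Delta hp hb) hij]
  congr 1
  ext k : 1
  have := hc i j hij
  simp only [Function.update_apply, Function.comp_apply, Equiv.swap_apply_def]
  split_ifs <;> simp_all

theorem exists_linearMap_U_update (u : (ι → A) → ℝ) (p : ι → A → ℝ) (i : ι) :
    ∃ l : (A → ℝ) →ₗ[ℝ] ℝ, ∀ v, U u (Function.update p i v) = l v := by
  classical
  refine ⟨∑ a, U u (Function.update p i (Pi.single a 1)) • LinearMap.proj a, fun v => ?_⟩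
  rw [← mixedExt_real, mixedExt_update]
  simp [mixedExt_real, mul_comm]

end Symmetry

section Centroid

variable {Y : ι → Finset A} {u : (ι → A) → ℝ} {cls : ι → κ} {p : ι → A → ℝ}

omit [DecidableEq ι] [Fintype A] in
theorem mem_cluster {i j : ι} : j ∈ cluster cls i ↔ cls j = cls i := by
  simp [cluster]

omit [DecidableEq ι] [Fintype A] in
theorem card_cluster_pos (cls : ι → κ) (i : ι) : (0 : ℝ) < (cluster cls i).card :=
  Nat.cast_pos.2 (Finset.card_pos.2 ⟨i, mem_cluster.2 rfl⟩)

omit [DecidableEq ι] [Fintype A] in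
theorem classConst_centroid (cls : ι → κ) (p : ι → A → ℝ) : classConst cls (centroid cls p) := by
  intro i j hij
  simp [centroid, cluster, hij]

omit [Fintype A] in
theorem centroid_mem_Delta (hpi : PermInvariant Y u cls) (hp : p ∈ Delta Y) :
    centroid cls p ∈ Delta Y := by
  have hY : ∀ i, ∀ j ∈ cluster cls i, Y j = Y i := fun i j hj => (hpi j i (mem_cluster.1 hj)).1
  intro i
  refine ⟨fun a => ?_, fun a ha => ?_, ?_⟩
  · simp only [centroid, Pi.smul_apply, Finset.sum_apply, smul_eq_mul]
    exact mul_nonneg (inv_nonneg.2 (Nat.cast_nonneg _)) (Finset.sum_nonneg fun j _ => (hp j).1 a)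
  · simp only [centroid, Pi.smul_apply, Finset.sum_apply, smul_eq_mul]
    rw [Finset.sum_eq_zero fun j hj => (hp j).2.1 a (by rwa [hY i j hj]), mul_zero]
  · simp only [centroid, Pi.smul_apply, Finset.sum_apply, smul_eq_mul]
    have hone : ∀ j ∈ cluster cls i, ∑ a ∈ Y i, p j a = 1 := fun j hj => by
      rw [← hY i j hj]
      exact (hp j).2.2
    rw [← Finset.mul_sum, Finset.sum_comm, Finset.sum_congr rfl hone, Finset.sum_const,
      nsmul_one, inv_mul_cancel₀ (card_cluster_pos cls i).ne']

omit [DecidableEq ι] [Fintype A] in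
theorem centroid_add_smul_sub (cls : ι → κ) (p b : ι → A → ℝ) (r : ℝ) :
    centroid cls (p + r • (b - p)) =
      centroid cls p + r • (centroid cls b - centroid cls p) := by
  ext i a
  simp only [centroid, Pi.add_apply, Pi.sub_apply, Pi.smul_apply, Finset.sum_apply, smul_eq_mul,
    Finset.sum_add_distrib, ← Finset.mul_sum, Finset.sum_sub_distrib]
  ring

/-- By symmetry, averaging over classes preserves best responses to class-constant profiles. -/
theorem centroid_mem_BR (hpi : PermInvariant Y u cls) (hp : p ∈ Delta Y) (hc : classConst cls p)
    {ε : ℝ} {b : ι → A → ℝ} (hb : b ∈ BR Y u ε p) : centroid cls b ∈ BR Y u ε p := by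
  intro i
  refine ⟨centroid_mem_Delta hpi (fun j => (hb j).1) i, fun v hv => ?_⟩
  obtain ⟨l, hl⟩ := exists_linearMap_U_update u p i
  have hresp : ∀ j ∈ cluster cls i, l v - ε ≤ l (b j) := by
    intro j hj
    have hji := mem_cluster.1 hj
    have hYij := (hpi j i hji).1
    have := (hb j).2 v (hYij ▸ hv)
    rwa [U_update_eq_of_cls_eq hpi hp hc hji (hb j).1,
      U_update_eq_of_cls_eq hpi hp hc hji (hYij ▸ hv), hl, hl] at this
  have hpos := card_cluster_pos cls i
  simp only [hl, centroid, map_smul, map_sum, smul_eq_mul]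
  rw [ge_iff_le, ← div_eq_inv_mul, le_div_iff₀ hpos, mul_comm, ← nsmul_eq_mul]
  exact Finset.card_nsmul_le_sum _ _ _ hresp

end Centroid

section Topology

omit [Fintype ι] [DecidableEq ι] [Fintype A] in
theorem le_one_of_mem_Delta {Y : ι → Finset A} {p : ι → A → ℝ} (hp : p ∈ Delta Y) (i : ι) (a : A) :
    p i a ≤ 1 := by
  by_cases ha : a ∈ Y i
  · rw [← (hp i).2.2]
    exact Finset.single_le_sum (fun b _ => (hp i).1 b) ha
  · rw [(hp i).2.1 a ha]
    exact zero_le_one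

omit [Fintype ι] [DecidableEq ι] [Fintype A] in
theorem isCompact_Delta (Y : ι → Finset A) : IsCompact (Delta Y) := by
  have hclosed : IsClosed (Delta Y) := by
    have : Delta Y = (⋂ i, ⋂ a, {p : ι → A → ℝ | 0 ≤ p i a}) ∩
        (⋂ i, ⋂ a, ⋂ _ : a ∉ Y i, {p : ι → A → ℝ | p i a = 0}) ∩
        ⋂ i, {p : ι → A → ℝ | ∑ a ∈ Y i, p i a = 1} := by
      ext p
      simp [Delta, simplex, forall_and, and_assoc]
    rw [this]
    refine ((isClosed_iInter fun i => isClosed_iInter fun a => ?_).inter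
      (isClosed_iInter fun i => isClosed_iInter fun a => isClosed_iInter fun _ => ?_)).inter
      (isClosed_iInter fun i => ?_)
    · exact isClosed_le continuous_const (by fun_prop)
    · exact isClosed_eq (by fun_prop) continuous_const
    · exact isClosed_eq (by fun_prop) continuous_const
  exact (isCompact_Icc (a := (0 : ι → A → ℝ)) (b := 1)).of_isClosed_subset hclosed
    fun p hp => ⟨fun i a => (hp i).1 a, fun i a => le_one_of_mem_Delta hp i a⟩

omit [Fintype ι] [DecidableEq ι] [Fintype A] [DecidableEq κ] in
theorem isCompact_Delta_classConst (Y : ι → Finset A) (cls : ι → κ) :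
    IsCompact {p ∈ Delta Y | classConst cls p} := by
  have : {p ∈ Delta Y | classConst cls p} =
      Delta Y ∩ ⋂ i, ⋂ j, ⋂ _ : cls i = cls j, {p : ι → A → ℝ | p i = p j} := by
    ext p
    simp [classConst]
  rw [this]
  exact (isCompact_Delta Y).inter_right <| isClosed_iInter fun i => isClosed_iInter fun j =>
    isClosed_iInter fun _ => isClosed_eq (by fun_prop) (by fun_prop)

theorem continuous_U (u : (ι → A) → ℝ) : Continuous (U u) := by
  unfold U
  fun_prop

end Topology

section Expansion

omit [Fintype ι] in
theorem exists_prod_add_mul_expansion_bound (s : Finset ι) :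
    ∃ C, 0 ≤ C ∧ ∀ (b c : ι → ℝ) (r : ℝ), (∀ i, |b i| ≤ 1) → (∀ i, |c i| ≤ 1) → 0 ≤ r → r ≤ 1 →
      |∏ i ∈ s, (b i + r * c i) - ∏ i ∈ s, b i - r * ∑ i ∈ s, c i * ∏ j ∈ s.erase i, b j| ≤
        C * r ^ 2 := by
  induction s using Finset.induction_on with
  | empty => exact ⟨0, le_rfl, by simp⟩
  | insert k s hk ih =>
    obtain ⟨C, hC0, hC⟩ := ih
    refine ⟨s.card + 2 * C, by positivity, fun b c r hb hc hr hr1 => ?_⟩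
    have hlin : ∑ i ∈ insert k s, c i * ∏ j ∈ (insert k s).erase i, b j =
        c k * ∏ j ∈ s, b j + b k * ∑ i ∈ s, c i * ∏ j ∈ s.erase i, b j := by
      rw [Finset.sum_insert hk, Finset.erase_insert hk, Finset.mul_sum]
      congr 1
      refine Finset.sum_congr rfl fun i hi => ?_
      have hki : k ≠ i := fun h => hk (h ▸ hi)
      rw [Finset.erase_insert_of_ne hki,
        Finset.prod_insert (fun h => hk (Finset.mem_of_mem_erase h))]
      ring
    have hS : |∑ i ∈ s, c i * ∏ j ∈ s.erase i, b j| ≤ s.card := by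
      refine (Finset.abs_sum_le_sum_abs _ _).trans ?_
      rw [← nsmul_one s.card]
      refine Finset.sum_le_card_nsmul _ _ _ fun i _ => ?_
      rw [abs_mul, Finset.abs_prod]
      exact mul_le_one₀ (hc i) (Finset.prod_nonneg fun _ _ => abs_nonneg _)
        (Finset.prod_le_one (fun _ _ => abs_nonneg _) fun j _ => hb j)
    have hR := hC b c r hb hc hr hr1
    rw [Finset.prod_insert hk, Finset.prod_insert hk, hlin]
    set P := ∏ i ∈ s, (b i + r * c i)
    set B := ∏ i ∈ s, b i
    set S := ∑ i ∈ s, c i * ∏ j ∈ s.erase i, b j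
    have hsplit : (b k + r * c k) * P - b k * B - r * (c k * B + b k * S) =
        r ^ 2 * (c k * S) + (b k + r * c k) * (P - B - r * S) := by ring
    have h1 : |r ^ 2 * (c k * S)| ≤ s.card * r ^ 2 := by
      rw [abs_mul, abs_mul, abs_of_nonneg (sq_nonneg r), mul_comm]
      refine mul_le_mul_of_nonneg_right ?_ (sq_nonneg r)
      calc |c k| * |S| ≤ 1 * |S| := mul_le_mul_of_nonneg_right (hc k) (abs_nonneg _)
        _ ≤ s.card := by rwa [one_mul]
    have h2 : |(b k + r * c k) * (P - B - r * S)| ≤ 2 * (C * r ^ 2) := by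
      rw [abs_mul]
      refine mul_le_mul ?_ hR (abs_nonneg _) two_pos.le
      refine (abs_add_le _ _).trans ?_
      rw [abs_mul, abs_of_nonneg hr]
      linarith [hb k, mul_le_one₀ hr1 (abs_nonneg _) (hc k)]
    rw [hsplit]
    refine (abs_add_le _ _).trans ?_
    linarith

theorem exists_U_add_smul_expansion_bound (u : (ι → A) → ℝ) :
    ∃ C, ∀ (p h : ι → A → ℝ) (r : ℝ), (∀ i a, |p i a| ≤ 1) → (∀ i a, |h i a| ≤ 1) → 0 ≤ r →
      r ≤ 1 →
      |U u (p + r • h) - U u p - r * ∑ i, U u (Function.update p i (h i))| ≤ C * r ^ 2 := by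
  obtain ⟨C, -, hC⟩ := exists_prod_add_mul_expansion_bound (Finset.univ : Finset ι)
  refine ⟨∑ y, |u y| * C, fun p h r hp hh hr hr1 => ?_⟩
  have hlin : U u (p + r • h) - U u p - r * ∑ i, U u (Function.update p i (h i)) =
      ∑ y, u y * (∏ i, (p i (y i) + r * h i (y i)) - ∏ i, p i (y i) -
        r * ∑ i, h i (y i) * ∏ j ∈ Finset.univ.erase i, p j (y j)) := by
    simp only [U, prod_update_apply, Pi.add_apply, Pi.smul_apply, smul_eq_mul, mul_sub,
      Finset.sum_sub_distrib]
    congr 1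
    rw [Finset.sum_comm, Finset.mul_sum]
    refine Finset.sum_congr rfl fun y _ => ?_
    rw [← Finset.mul_sum]
    ring
  rw [hlin, Finset.sum_mul]
  refine (Finset.abs_sum_le_sum_abs _ _).trans (Finset.sum_le_sum fun y _ => ?_)
  rw [abs_mul, mul_assoc]
  exact mul_le_mul_of_nonneg_left
    (hC _ _ r (fun i => hp i (y i)) (fun i => hh i (y i)) hr hr1) (abs_nonneg _)

omit [Fintype ι] [DecidableEq ι] [Fintype A] in
theorem abs_sub_le_one_of_mem_Delta {Y : ι → Finset A} {p b : ι → A → ℝ} (hp : p ∈ Delta Y)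
    (hb : b ∈ Delta Y) (i : ι) (a : A) : |(b - p) i a| ≤ 1 := by
  simp only [Pi.sub_apply]
  rw [abs_le]
  have := (hp i).1 a
  have := (hb i).1 a
  have := le_one_of_mem_Delta hp i a
  have := le_one_of_mem_Delta hb i a
  constructor <;> linarith

/-- A small step towards an `ε`-best response raises the utility at least as fast as the best
unilateral gain, up to an error linear in `ε` and the step size. -/
theorem exists_U_gain_of_step_toward_BR (Y : ι → Finset A) (u : (ι → A) → ℝ) :
    ∃ C, ∀ p ∈ Delta Y, ∀ (ε r : ℝ), 0 ≤ r → r ≤ 1 → 0 ≤ ε → ∀ b ∈ BR Y u ε p,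
      ∀ i, ∀ v ∈ simplex (Y i),
        r * (U u (Function.update p i v) - U u p - (Fintype.card ι * ε + C * r)) ≤
          U u (p + r • (b - p)) - U u p := by
  obtain ⟨C, hC⟩ := exists_U_add_smul_expansion_bound u
  refine ⟨C, fun p hp ε r hr hr1 hε b hb i v hv => ?_⟩
  have hexp := hC p (b - p) r
    (fun i a => abs_le.2 ⟨by linarith [(hp i).1 a], le_one_of_mem_Delta hp i a⟩)
    (abs_sub_le_one_of_mem_Delta hp fun i => (hb i).1) hr hr1
  have hgain : ∀ k, U u (Function.update p k ((b - p) k)) =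
      U u (Function.update p k (b k)) - U u p := by
    intro k
    obtain ⟨l, hl⟩ := exists_linearMap_U_update u p k
    have hself := hl (p k)
    rw [Function.update_eq_self] at hself
    rw [hl, hl, hself, Pi.sub_apply, map_sub]
  have hlow : ∀ k, -ε ≤ U u (Function.update p k (b k)) - U u p := by
    intro k
    have := (hb k).2 (p k) (hp k)
    rw [Function.update_eq_self] at this
    linarith
  have hsum : U u (Function.update p i v) - U u p - Fintype.card ι * ε ≤
      ∑ k, (U u (Function.update p k (b k)) - U u p) := by
    have hi := Finset.single_le_sum
      (f := fun k => U u (Function.update p k (b k)) - U u p + ε)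
      (fun k _ => by linarith [hlow k]) (Finset.mem_univ i)
    rw [Finset.sum_add_distrib, Finset.sum_const, nsmul_eq_mul, Finset.card_univ] at hi
    linarith [(hb i).2 v hv]
  simp only [hgain] at hexp
  have := mul_le_mul_of_nonneg_left hsum hr
  rw [abs_le] at hexp
  linarith [hexp.1]

end Expansion
variable [Nonempty ι]

/-- **Theorem 1(ii).** In any discrete-time ECFP process for an identical-interests game with
a permutation-invariant partition, the centroid distributions learn symmetric Nash equilibria:
`dist(q̄(t), SNE) → 0`. -/
theorem ecfp_centroid_learns_SNE
    (Y : ι → Finset A) (hY : ∀ i, (Y i).Nonempty) (u : (ι → A) → ℝ)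
    (cls : ι → κ) (hpi : PermInvariant Y u cls)
    (γ ε : ℕ → ℝ) (a q : ℕ → ι → A → ℝ)
    (hproc : IsECFP Y u cls γ ε a q)
    (hγnonneg : ∀ t, 0 ≤ γ t)
    (hγdiv : Tendsto (fun n => ∑ t ∈ Finset.range n, γ t) atTop atTop)
    (hγ0 : Tendsto γ atTop (𝓝 0))
    (hεnonneg : ∀ t, 0 ≤ ε t)
    (hε0 : Tendsto ε atTop (𝓝 0)) :
    Tendsto (fun t => Metric.infDist (centroid cls (q t)) (SNE Y u cls)) atTop (𝓝 0) := by
  obtain ⟨C, hC⟩ := exists_U_gain_of_step_toward_BR Y u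
  set y : ℕ → ι → A → ℝ := fun t => centroid cls (q t) with hy
  have hyΔ : ∀ t, y t ∈ Delta Y := fun t => centroid_mem_Delta hpi (hproc.q_mem t)
  have hyc : ∀ t, classConst cls (y t) := fun t => classConst_centroid cls (q t)
  have hbr : ∀ t, centroid cls (a (t + 1)) ∈ BR Y u (ε t) (y t) := fun t =>
    centroid_mem_BR hpi (hyΔ t) (hyc t) (hproc.br t)
  have hystep : ∀ t, y (t + 1) = y t + γ t • (centroid cls (a (t + 1)) - y t) := fun t => by
    simp only [hy, hproc.step t, centroid_add_smul_sub]
  let d : (Σ i, simplex (Y i)) → (ι → A → ℝ) → ℝ := fun j p =>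
    U u (Function.update p j.1 j.2.1) - U u p
  have hd : ∀ j, Continuous (d j) := fun j =>
    ((continuous_U u).comp (continuous_id.update j.1 continuous_const)).sub (continuous_U u)
  have hSNE : SNE Y u cls = {p ∈ {p ∈ Delta Y | classConst cls p} | ∀ j, d j p ≤ 0} := by
    ext p
    simp only [SNE, NE, d, Set.mem_ofPred_eq, Sigma.forall, Subtype.forall, sub_nonpos]
    tauto
  let δ : ℕ → ℝ := fun t => Fintype.card ι * ε t + C * γ t
  have hδ0 : Tendsto δ atTop (𝓝 0) := by
    simpa using (hε0.const_mul (Fintype.card ι : ℝ)).add (hγ0.const_mul C)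
  have hinc : ∀ᶠ t in atTop, ∀ j, γ t * (d j (y t) - δ t) ≤ U u (y (t + 1)) - U u (y t) := by
    filter_upwards [hγ0.eventually_le_const one_pos] with t ht j
    rw [hystep]
    exact hC _ (hyΔ t) _ _ (hγnonneg t) ht (hεnonneg t) _ (hbr t) j.1 _ j.2.2
  rw [hSNE]
  refine tendsto_infDist_of_perturbed_ascent (isCompact_Delta_classConst Y cls) (continuous_U u) hd
    (fun t => ⟨hyΔ t, hyc t⟩) hγnonneg hγdiv hγ0 hδ0 (fun t => ?_) ?_ hinc ?_
  · change dist (y t) (y (t + 1)) ≤ γ t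
    rw [hystep, dist_eq_norm', add_sub_cancel_left, norm_smul, Real.norm_of_nonneg (hγnonneg t)]
    refine mul_le_of_le_one_right (hγnonneg t) ?_
    exact (pi_norm_le_iff_of_nonneg zero_le_one).2 fun i =>
      (pi_norm_le_iff_of_nonneg zero_le_one).2 fun b =>
        abs_sub_le_one_of_mem_Delta (hyΔ t) (fun i => (hbr t i).1) i b
  · filter_upwards [hinc] with t ht
    obtain ⟨i⟩ := ‹Nonempty ι›
    have := ht ⟨i, y t i, hyΔ t i⟩
    simp only [d, Function.update_eq_self] at this
    linarith
  · rw [← hSNE]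
    exact (finite_image_U_NE Y u).subset (Set.image_mono fun p hp => hp.1)

end ECFP
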